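/- Let K ≥ 2, let 1 ≤ n ≤ K, let η ≥ 0, T a positive integer, and ϱ ≥ 0. For each k ∈ {1, …, K} let a_k = η·∑_{t=1}^{T} g_{k,t} where g_{k,t} are vectors in a real inner product space with ‖g_{k,t}‖ ≤ ϱ for all k, t, and let ā = (1/K)·∑_{k=1}^{K} a_k. If S is a subset of {1, …, K} of size n chosen uniformly at random (averaging over all C(K,n) size-n subsets with equal weight), then E_S[‖(1/n)·∑_{k∈S} a_k − ā‖²] ≤ ((K − n)/(n·(K − 1))) · η²·T²·ϱ². In particular, when n = K the left-hand side is zero. -/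

import Mathlib

lemma aux_count (K m : ℕ) (i j : Fin K) (hij : i ≠ j) :
    ((Finset.powersetCard (m+1) (Finset.univ : Finset (Fin K))).filter
      (fun S => i ∈ S ∧ j ∉ S)).card = (K-2).choose m := by
  have h2 : (((Finset.univ : Finset (Fin K)).erase i).erase j).card = K - 2 := by
    rw [Finset.card_erase_of_mem (by simp [hij.symm]), Finset.card_erase_of_mem (by simp)]
    simp; omega
  rw [← h2, ← Finset.card_powersetCard]
  refine Finset.card_nbij' (fun S => S.erase i) (fun S => insert i S) ?_ ?_ ?_ ?_
  · intro S hS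
    simp only [Finset.coe_filter, Finset.mem_powersetCard, Set.mem_setOf_eq] at hS
    simp only [Finset.mem_coe, Finset.mem_powersetCard]
    obtain ⟨⟨_, hc⟩, hi, hj⟩ := hS
    refine ⟨?_, by rw [Finset.card_erase_of_mem hi]; omega⟩
    intro x hx
    simp only [Finset.mem_erase, Finset.mem_univ, and_true] at hx ⊢
    exact ⟨fun h => hj (h ▸ hx.2), hx.1⟩
  · intro S hS
    simp only [Finset.mem_coe, Finset.mem_powersetCard] at hS
    obtain ⟨hs, hc⟩ := hS
    have hi : i ∉ S := fun h => by simpa using hs h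
    have hj : j ∉ S := fun h => by simpa using hs h
    simp [Finset.mem_powersetCard, Finset.card_insert_of_notMem hi, hc, hj, hij.symm]
  · intro S hS
    simp only [Finset.coe_filter, Set.mem_setOf_eq] at hS
    exact Finset.insert_erase hS.2.1
  · intro S hS
    simp only [Finset.mem_coe, Finset.mem_powersetCard] at hS
    exact Finset.erase_insert (fun h => by simpa using hS.1 h)

lemma aux_sum {V : Type*} [NormedAddCommGroup V] [InnerProductSpace ℝ V] (K m : ℕ)
    (b : Fin K → V) (hb : ∑ k, b k = 0) :
    ∑ S ∈ Finset.powersetCard (m+1) (Finset.univ : Finset (Fin K)), ‖∑ k ∈ S, b k‖ ^ 2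
      = ((K-2).choose m : ℝ) * ∑ k, ‖b k‖ ^ 2 := by
  have h1 : ∀ S : Finset (Fin K), ‖∑ k ∈ S, b k‖ ^ 2
      = - ∑ i, ∑ j, if i ∈ S ∧ j ∉ S then inner ℝ (b i) (b j) else 0 := by
    intro S
    have hc : ∑ k ∈ S, b k = - ∑ k ∈ Sᶜ, b k := by
      rw [eq_neg_iff_add_eq_zero, Finset.sum_add_sum_compl, hb]
    rw [← real_inner_self_eq_norm_sq]
    nth_rewrite 2 [hc]
    rw [inner_neg_right, sum_inner, neg_inj]
    rw [← Finset.sum_filter_add_sum_filter_not Finset.univ (· ∈ S)]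
    rw [Finset.sum_eq_zero (s := Finset.univ.filter (fun x => ¬ x ∈ S))]
    · simp only [Finset.filter_univ_mem, add_zero]
      refine Finset.sum_congr rfl fun i hi => ?_
      rw [inner_sum, ← Finset.sum_filter]
      refine Finset.sum_congr ?_ fun _ _ => rfl
      ext; simp [hi]
    · intro x hx
      simp at hx
      simp [hx]
  simp_rw [h1]
  rw [Finset.sum_neg_distrib, Finset.sum_comm]
  have h2 : ∀ i : Fin K, ∑ S ∈ Finset.powersetCard (m+1) (Finset.univ : Finset (Fin K)),
      ∑ j, (if i ∈ S ∧ j ∉ S then inner ℝ (b i) (b j) else 0)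
      = - (((K-2).choose m : ℝ) * ‖b i‖ ^ 2) := by
    intro i
    rw [Finset.sum_comm]
    have h3 : ∀ j : Fin K, ∑ S ∈ Finset.powersetCard (m+1) (Finset.univ : Finset (Fin K)),
        (if i ∈ S ∧ j ∉ S then inner ℝ (b i) (b j) else 0)
        = ((K-2).choose m : ℝ) * inner ℝ (b i) (b j)
          - if j = i then ((K-2).choose m : ℝ) * inner ℝ (b i) (b j) else 0 := by
      intro j
      by_cases h : j = i
      · subst h; simp
      · rw [← Finset.sum_filter, Finset.sum_const, aux_count K m i j (Ne.symm h)]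
        simp [h]
    simp_rw [h3]
    rw [Finset.sum_sub_distrib, ← Finset.mul_sum, ← inner_sum, hb]
    simp
  simp_rw [h2]
  simp [Finset.mul_sum]

lemma aux_choose (K m : ℕ) (hK : 2 ≤ K) (hm : m + 1 ≤ K) :
    (K.choose (m+1) : ℝ) * ((m+1) * (K - (m+1))) = K * (K-1) * (K-2).choose m := by
  obtain ⟨L, rfl⟩ := Nat.exists_eq_add_of_le' hK
  have e1 := Nat.add_one_mul_choose_eq (L+1) m
  have e2 := Nat.choose_mul_succ_eq L m
  obtain ⟨d, hd⟩ := Nat.exists_eq_add_of_le' (show m ≤ L + 1 by omega)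
  have hd' : L + 1 - m = d := by omega
  rw [hd'] at e2
  have hdr : (L:ℝ) + 1 = d + m := by exact_mod_cast hd
  have e1' : ((L:ℝ)+1+1) * (L+1).choose m = (L+1+1).choose (m+1) * (m+1) := by exact_mod_cast e1
  have e2' : (L.choose m : ℝ) * (L+1) = (L+1).choose m * d := by exact_mod_cast e2
  have : L + 2 - 2 = L := by omega
  rw [this]
  push_cast
  have h4 : (L:ℝ) + 2 - (m+1) = d := by linarith
  rw [h4]
  linear_combination (-(d:ℝ)) * e1' - (L+2) * e2'


/-- Lemma 1 of the paper: if each `a_k = η ∑_{t=1}^T g_{k,t}` with `‖g_{k,t}‖ ≤ ϱ`, then the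
expected squared gap between the subset mean over a uniformly random size-`n` subset and the
full mean `ā = (1/K) ∑_k a_k` is at most `((K-n)/(n(K-1))) η² T² ϱ²`; in particular for
`n = K` it is zero. -/
theorem stmt_15 {V : Type*} [NormedAddCommGroup V] [InnerProductSpace ℝ V]
    (K n T : ℕ) (hK : 2 ≤ K) (hn : 1 ≤ n) (hnK : n ≤ K) (hT : 1 ≤ T)
    (η ϱ : ℝ) (hη : 0 ≤ η) (hϱ : 0 ≤ ϱ)
    (g : Fin K → Fin T → V) (hg : ∀ k t, ‖g k t‖ ≤ ϱ)
    (a : Fin K → V) (ha : ∀ k, a k = η • ∑ t, g k t) :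
    (((K.choose n : ℝ)⁻¹) *
        ∑ S ∈ Finset.powersetCard n (Finset.univ : Finset (Fin K)),
          ‖((n : ℝ)⁻¹) • (∑ k ∈ S, a k) - ((K : ℝ)⁻¹) • ∑ j, a j‖ ^ 2
      ≤ (((K : ℝ) - (n : ℝ)) / ((n : ℝ) * ((K : ℝ) - 1))) * η ^ 2 * (T : ℝ) ^ 2 * ϱ ^ 2)
    ∧ (n = K →
        ((K.choose n : ℝ)⁻¹) *
            ∑ S ∈ Finset.powersetCard n (Finset.univ : Finset (Fin K)),
              ‖((n : ℝ)⁻¹) • (∑ k ∈ S, a k) - ((K : ℝ)⁻¹) • ∑ j, a j‖ ^ 2 = 0) := by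
  obtain ⟨m, rfl⟩ := Nat.exists_eq_add_of_le' hn
  have hK0 : (2:ℝ) ≤ K := by exact_mod_cast hK
  have hKne : (K:ℝ) ≠ 0 := by linarith
  have hK1 : (0:ℝ) < (K:ℝ) - 1 := by linarith
  have hmne : ((m+1 : ℕ):ℝ) ≠ 0 := by positivity
  have hmK : ((m+1 : ℕ):ℝ) ≤ K := by exact_mod_cast hnK
  set c : V := ((K : ℝ)⁻¹) • ∑ j, a j with hc
  have hKc : (K:ℝ) • c = ∑ j, a j := by rw [hc, smul_inv_smul₀ hKne]
  have hb : ∑ k, (a k - c) = 0 := by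
    rw [Finset.sum_sub_distrib, ← hKc]
    simp [← Nat.cast_smul_eq_nsmul ℝ]
  have hterm : ∀ S ∈ Finset.powersetCard (m+1) (Finset.univ : Finset (Fin K)),
      ‖(((m+1 : ℕ) : ℝ)⁻¹) • (∑ k ∈ S, a k) - c‖ ^ 2
        = (((m+1 : ℕ) : ℝ)⁻¹) ^ 2 * ‖∑ k ∈ S, (a k - c)‖ ^ 2 := by
    intro S hS
    have hcard := (Finset.mem_powersetCard.1 hS).2
    have : (((m+1 : ℕ) : ℝ)⁻¹) • (∑ k ∈ S, a k) - c
        = (((m+1 : ℕ) : ℝ)⁻¹) • ∑ k ∈ S, (a k - c) := by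
      rw [Finset.sum_sub_distrib, Finset.sum_const, hcard, smul_sub,
        ← Nat.cast_smul_eq_nsmul ℝ, inv_smul_smul₀ hmne]
    rw [this, norm_smul, mul_pow, Real.norm_eq_abs, sq_abs]
  have hB : ∑ k, ‖a k - c‖ ^ 2 ≤ K * (η * T * ϱ) ^ 2 := by
    have h1 : ∑ k, ‖a k - c‖ ^ 2 = ∑ k, ‖a k‖ ^ 2 - K * ‖c‖ ^ 2 := by
      simp_rw [norm_sub_sq_real]
      rw [Finset.sum_add_distrib, Finset.sum_sub_distrib, ← Finset.mul_sum, ← sum_inner, ← hKc,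
        real_inner_smul_left, real_inner_self_eq_norm_sq]
      simp
      ring
    have h2 : ∀ k, ‖a k‖ ^ 2 ≤ (η * T * ϱ) ^ 2 := by
      intro k
      have : ‖a k‖ ≤ η * T * ϱ := by
        rw [ha, norm_smul, Real.norm_eq_abs, abs_of_nonneg hη, mul_assoc]
        gcongr
        refine (norm_sum_le _ _).trans ((Finset.sum_le_sum fun t _ => hg k t).trans ?_)
        simp
      gcongr
    have h3 : ∑ k, ‖a k‖ ^ 2 ≤ K * (η * T * ϱ) ^ 2 :=
      (Finset.sum_le_sum fun k _ => h2 k).trans (by simp)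
    have : 0 ≤ (K:ℝ) * ‖c‖ ^ 2 := by positivity
    linarith
  have hch : (0:ℝ) < K.choose (m+1) := by exact_mod_cast Nat.choose_pos hnK
  have hkey : ((K.choose (m+1) : ℝ)⁻¹) *
        ∑ S ∈ Finset.powersetCard (m+1) (Finset.univ : Finset (Fin K)),
          ‖(((m+1 : ℕ) : ℝ)⁻¹) • (∑ k ∈ S, a k) - c‖ ^ 2
      = (((K : ℝ) - ((m+1 : ℕ) : ℝ)) / (((m+1 : ℕ) : ℝ) * ((K : ℝ) - 1)))
        * ((K:ℝ)⁻¹ * ∑ k, ‖a k - c‖ ^ 2) := by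
    rw [Finset.sum_congr rfl hterm, ← Finset.mul_sum, aux_sum K m _ hb]
    have h := aux_choose K m hK hnK
    push_cast at hmne ⊢
    have hK1' := hK1.ne'
    generalize ∑ k, ‖a k - c‖ ^ 2 = B
    field_simp
    linear_combination (-B) * h
  rw [hkey]
  constructor
  · have h5 : (K:ℝ)⁻¹ * ∑ k, ‖a k - c‖ ^ 2 ≤ (η * T * ϱ) ^ 2 := by
      rw [inv_mul_le_iff₀ (by linarith)]; exact hB
    have h6 : 0 ≤ ((K : ℝ) - ((m+1 : ℕ) : ℝ)) / (((m+1 : ℕ) : ℝ) * ((K : ℝ) - 1)) :=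
      div_nonneg (by linarith) (by positivity)
    calc _ ≤ _ := mul_le_mul_of_nonneg_left h5 h6
      _ = _ := by ring
  · intro h
    rw [h]; simp
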